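/- Consider the HAR method run on F = f + ψ. For every k ≥ 1 and every d ∈ ℝ^n, F(x^{k−0.5}) + ((σ_k − H_k)/(p+1)!) ‖d^k‖^{p+1} ≤ F(x^{k−1} + d) + ((σ_k + L_p)/(p+1)!) ‖d‖^{p+1}. In particular, for every successful iteration k ∈ S one has σ_k − H_k ≥ (α−1)M_k/2 > 0 and hence F(x^k) ≤ F(x^{k−1} + d) + ((σ_k + L_p)/(p+1)!) ‖d‖^{p+1} for all d ∈ ℝ^n. -/

import Mathlib

open scoped BigOperators RealInnerProductSpace

noncomputable section

/-- The `p`-th order Taylor polynomial `T_p(y; x)` of `f` at `x`, evaluated at `y`. -/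
def taylorPoly {n : ℕ} (p : ℕ) (f : EuclideanSpace ℝ (Fin n) → ℝ)
    (x y : EuclideanSpace ℝ (Fin n)) : ℝ :=
  f x + ∑ ℓ ∈ Finset.Icc 1 p,
    (1 / (Nat.factorial ℓ : ℝ)) * iteratedFDeriv ℝ ℓ f x (fun _ => y - x)

/-- The regularized Taylor polynomial `Ω_p^σ(y; x)`. -/
def omegaReg {n : ℕ} (p : ℕ) (σ : ℝ) (f : EuclideanSpace ℝ (Fin n) → ℝ)
    (x y : EuclideanSpace ℝ (Fin n)) : ℝ :=
  taylorPoly p f x y + σ / (Nat.factorial (p + 1) : ℝ) * ‖y - x‖ ^ (p + 1)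

/-- `H_max = max {H₀, L_p}`. -/
def Hmax (H0 Lp : ℝ) : ℝ := max H0 Lp

/-- `Ū = ⌈log_{(α+1)/2} (H_max / H₀)⌉`. -/
def Ubar (α H0 Lp : ℝ) : ℤ := ⌈Real.logb ((α + 1) / 2) (Hmax H0 Lp / H0)⌉

/-- If `G 0, …, G p` are successive derivatives and `G p` decreases from `0` at rate at most `C`,
then `G 0` is bounded below by its Taylor polynomial at `0` minus `C * t ^ (p + 1) / (p + 1)!`. -/
theorem taylor_sum_sub_le_of_hasDerivAt (C : ℝ) (p : ℕ) (G : ℕ → ℝ → ℝ)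
    (hG : ∀ l < p, ∀ t, HasDerivAt (G l) (G (l + 1) t) t)
    (hC : ∀ t, 0 ≤ t → G p 0 - C * t ≤ G p t) (t : ℝ) (ht : 0 ≤ t) :
    ∑ l ∈ Finset.range (p + 1), G l 0 * (t ^ l / (Nat.factorial l : ℝ))
      - C * (t ^ (p + 1) / (Nat.factorial (p + 1) : ℝ)) ≤ G 0 t := by
  have hpow : ∀ (l : ℕ) (s : ℝ), HasDerivAt
      (fun s : ℝ => s ^ (l + 1) / (Nat.factorial (l + 1) : ℝ))
      (s ^ l / (Nat.factorial l : ℝ)) s := by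
    intro l s
    have h := (hasDerivAt_pow (l + 1) s).div_const (Nat.factorial (l + 1) : ℝ)
    refine h.congr_deriv ?_
    rw [Nat.factorial_succ]
    push_cast
    field_simp
  induction p generalizing G t with
  | zero => simpa using hC t ht
  | succ p ih =>
    have hd : ∀ s, HasDerivAt
        (fun s => G 0 s - (∑ l ∈ Finset.range (p + 1),
            G (l + 1) 0 * (s ^ (l + 1) / (Nat.factorial (l + 1) : ℝ))
          - C * (s ^ (p + 1 + 1) / (Nat.factorial (p + 1 + 1) : ℝ))))
        (G 1 s - (∑ l ∈ Finset.range (p + 1), G (l + 1) 0 * (s ^ l / (Nat.factorial l : ℝ))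
          - C * (s ^ (p + 1) / (Nat.factorial (p + 1) : ℝ)))) s := fun s =>
      (hG 0 p.succ_pos s).sub
        ((HasDerivAt.fun_sum fun l _ => (hpow l s).const_mul (G (l + 1) 0)).sub
          ((hpow (p + 1) s).const_mul C))
    have hmono := monotoneOn_of_deriv_nonneg (convex_Ici (0 : ℝ))
      (fun s _ => (hd s).continuousAt.continuousWithinAt)
      (fun s _ => (hd s).differentiableAt.differentiableWithinAt)
      (fun s hs => by
        rw [interior_Ici] at hs
        rw [(hd s).deriv, sub_nonneg]
        exact ih (fun l => G (l + 1)) (fun l hl => hG (l + 1) (by omega)) hC s hs.le)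
    have h := hmono Set.self_mem_Ici (Set.mem_Ici.2 ht) ht
    rw [Finset.sum_range_succ']
    simp at h ⊢
    linarith

/-- The derivative along the line `t ↦ x + t • v` of the `l`-th derivative of `f` applied to
`(v, …, v)`. -/
theorem ContDiff.hasDerivAt_iteratedFDeriv_line {E F : Type*} [NormedAddCommGroup E]
    [NormedSpace ℝ E] [NormedAddCommGroup F] [NormedSpace ℝ F] {p : ℕ} {f : E → F}
    (hf : ContDiff ℝ p f) {l : ℕ} (hl : l < p) (x v : E) (t : ℝ) :
    HasDerivAt (fun s : ℝ => iteratedFDeriv ℝ l f (x + s • v) (fun _ => v))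
      (iteratedFDeriv ℝ (l + 1) f (x + t • v) (fun _ => v)) t := by
  have hline : HasDerivAt (fun s : ℝ => x + s • v) v t := by
    simpa using ((hasDerivAt_id t).smul_const v).const_add x
  have hD := (hf.differentiable_iteratedFDeriv (by exact_mod_cast hl) (x + t • v)).hasFDerivAt
  have hcomp := hD.comp_hasDerivAt t hline
  exact ((ContinuousMultilinearMap.apply ℝ (fun _ : Fin l => E) F
    (fun _ => v)).hasFDerivAt).comp_hasDerivAt t hcomp

/-- If the `p`-th derivative of `f` is `Lp`-Lipschitz, the Taylor polynomial of order `p` exceeds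
`f` by at most `Lp / (p + 1)! * ‖v‖ ^ (p + 1)`. -/
theorem taylorPoly_le_of_lipschitz {n p : ℕ} {f : EuclideanSpace ℝ (Fin n) → ℝ} {Lp : ℝ}
    (hf : ContDiff ℝ p f)
    (hLip : ∀ x y : EuclideanSpace ℝ (Fin n),
      ‖iteratedFDeriv ℝ p f x - iteratedFDeriv ℝ p f y‖ ≤ Lp * ‖x - y‖)
    (x v : EuclideanSpace ℝ (Fin n)) :
    taylorPoly p f x (x + v)
      ≤ f (x + v) + Lp / (Nat.factorial (p + 1) : ℝ) * ‖v‖ ^ (p + 1) := by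
  have h := taylor_sum_sub_le_of_hasDerivAt (Lp * ‖v‖ ^ (p + 1)) p
    (fun l t => iteratedFDeriv ℝ l f (x + t • v) (fun _ => v))
    (fun l hl t => hf.hasDerivAt_iteratedFDeriv_line hl x v t)
    (fun t ht => by
      have happ := (iteratedFDeriv ℝ p f (x + (0 : ℝ) • v)
        - iteratedFDeriv ℝ p f (x + t • v)).le_opNorm (fun _ => v)
      have hnorm := hLip (x + (0 : ℝ) • v) (x + t • v)
      have hdist : ‖x + (0 : ℝ) • v - (x + t • v)‖ = t * ‖v‖ := by
        rw [zero_smul, add_zero, sub_add_cancel_left, norm_neg, norm_smul, Real.norm_of_nonneg ht]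
      rw [hdist] at hnorm
      have hmul := mul_le_mul_of_nonneg_right hnorm (pow_nonneg (norm_nonneg v) p)
      simp only [Finset.prod_const, Finset.card_univ, Fintype.card_fin] at happ
      have habs := (le_abs_self _).trans (happ.trans hmul)
      rw [sub_apply] at habs
      rw [pow_succ]
      linarith)
    1 zero_le_one
  have hsum : taylorPoly p f x (x + v) = ∑ l ∈ Finset.range (p + 1),
      iteratedFDeriv ℝ l f x (fun _ => v) * (1 / (Nat.factorial l : ℝ)) := by
    rw [taylorPoly, Finset.sum_range_succ', Finset.range_eq_Ico,
      Finset.sum_Ico_add' (fun l => iteratedFDeriv ℝ l f x (fun _ => v)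
        * (1 / (Nat.factorial l : ℝ))) 0 p 1, ← Finset.Ico_add_one_right_eq_Icc]
    simp [add_comm, mul_comm]
  rw [hsum]
  simp only [zero_smul, add_zero, one_smul, one_pow, iteratedFDeriv_zero_apply] at h
  have hcomm : Lp / (Nat.factorial (p + 1) : ℝ) * ‖v‖ ^ (p + 1)
      = Lp * ‖v‖ ^ (p + 1) * (1 / (Nat.factorial (p + 1) : ℝ)) := by ring
  linarith

theorem HAR_global_descent_inequality
    {n : ℕ} (p : ℕ) (hp : 1 ≤ p)
    (f : EuclideanSpace ℝ (Fin n) → ℝ) (Lp : ℝ)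
    (hf : ContDiff ℝ p f)
    (hLip : ∀ x y : EuclideanSpace ℝ (Fin n),
      ‖iteratedFDeriv ℝ p f x - iteratedFDeriv ℝ p f y‖ ≤ Lp * ‖x - y‖)
    (domψ : Set (EuclideanSpace ℝ (Fin n))) (ψ : EuclideanSpace ℝ (Fin n) → ℝ)
    (hdom_ne : domψ.Nonempty) (hdom_closed : IsClosed domψ) (hdom_conv : Convex ℝ domψ)
    (hψconv : ConvexOn ℝ domψ ψ) (hψlsc : LowerSemicontinuousOn ψ domψ)
    (xstar : EuclideanSpace ℝ (Fin n)) (hstar : xstar ∈ domψ)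
    (hminF : ∀ z ∈ domψ, f xstar + ψ xstar ≤ f z + ψ z)
    (α : ℝ) (hα : 1 < α)
    (x d : ℕ → EuclideanSpace ℝ (Fin n)) (H M : ℕ → ℝ)
    (hx0 : x 0 ∈ domψ) (hH0 : 0 < H 0) (hM0 : M 0 = H 0)
    (hM : ∀ k, 1 ≤ k → M k = max (M (k - 1)) (H (k - 1)))
    (hdmem : ∀ k, 1 ≤ k → x (k - 1) + d k ∈ domψ)
    (hdmin : ∀ k, 1 ≤ k → ∀ z ∈ domψ,
      omegaReg p (α * M k) f (x (k - 1)) (x (k - 1) + d k) + ψ (x (k - 1) + d k)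
        ≤ omegaReg p (α * M k) f (x (k - 1)) z + ψ z)
    (hdne : ∀ k, 1 ≤ k → d k ≠ 0)
    (hxk : ∀ k, 1 ≤ k →
      x k = if f (x (k - 1) + d k) + ψ (x (k - 1) + d k) ≤ f (x (k - 1)) + ψ (x (k - 1))
            then x (k - 1) + d k else x (k - 1))
    (hHk : ∀ k, 1 ≤ k → H k / (Nat.factorial (p + 1) : ℝ)
      = (f (x (k - 1) + d k) - taylorPoly p f (x (k - 1)) (x (k - 1) + d k)) / ‖d k‖ ^ (p + 1)) :
    ∀ k : ℕ, 1 ≤ k →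
      (∀ dd : EuclideanSpace ℝ (Fin n), x (k - 1) + dd ∈ domψ →
        f (x (k - 1) + d k) + ψ (x (k - 1) + d k)
            + ((α * M k - H k) / (Nat.factorial (p + 1) : ℝ)) * ‖d k‖ ^ (p + 1)
          ≤ f (x (k - 1) + dd) + ψ (x (k - 1) + dd)
            + ((α * M k + Lp) / (Nat.factorial (p + 1) : ℝ)) * ‖dd‖ ^ (p + 1)) ∧
      (2 * H k ≤ (α + 1) * M k →
        ((α - 1) * M k / 2 ≤ α * M k - H k ∧ 0 < α * M k - H k) ∧
        ∀ dd : EuclideanSpace ℝ (Fin n), x (k - 1) + dd ∈ domψ →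
          f (x k) + ψ (x k)
            ≤ f (x (k - 1) + dd) + ψ (x (k - 1) + dd)
              + ((α * M k + Lp) / (Nat.factorial (p + 1) : ℝ)) * ‖dd‖ ^ (p + 1)) := by
  intro k hk
  have hdescent : ∀ dd : EuclideanSpace ℝ (Fin n), x (k - 1) + dd ∈ domψ →
      f (x (k - 1) + d k) + ψ (x (k - 1) + d k)
          + ((α * M k - H k) / (Nat.factorial (p + 1) : ℝ)) * ‖d k‖ ^ (p + 1)
        ≤ f (x (k - 1) + dd) + ψ (x (k - 1) + dd)
          + ((α * M k + Lp) / (Nat.factorial (p + 1) : ℝ)) * ‖dd‖ ^ (p + 1) := by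
    intro dd hdd
    have hopt := hdmin k hk _ hdd
    have htaylor := taylorPoly_le_of_lipschitz hf hLip (x (k - 1)) dd
    have hH := hHk k hk
    rw [eq_div_iff (pow_ne_zero _ (norm_ne_zero_iff.2 (hdne k hk)))] at hH
    simp only [omegaReg, add_sub_cancel_left] at hopt
    rw [sub_div, add_div, sub_mul, add_mul]
    linarith
  have hMpos : 0 < M k := by
    clear hdescent
    induction k, hk using Nat.le_induction with
    | base => rw [hM 1 le_rfl]; exact lt_max_of_lt_right hH0
    | succ m hm ih => rw [hM (m + 1) (by omega)]; exact lt_max_of_lt_left ih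
  refine ⟨hdescent, fun hS => ?_⟩
  have hgap : (α - 1) * M k / 2 ≤ α * M k - H k := by linarith
  have hpos : 0 < α * M k - H k :=
    (half_pos (mul_pos (sub_pos.2 hα) hMpos)).trans_le hgap
  refine ⟨⟨hgap, hpos⟩, fun dd hdd => ?_⟩
  have hle : f (x k) + ψ (x k) ≤ f (x (k - 1) + d k) + ψ (x (k - 1) + d k) := by
    rw [hxk k hk]
    split_ifs with h
    · exact le_rfl
    · exact (not_le.1 h).le
  have hnonneg : 0 ≤ (α * M k - H k) / (Nat.factorial (p + 1) : ℝ) * ‖d k‖ ^ (p + 1) := by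
    positivity
  linarith [hdescent dd hdd]
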